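/- (Theorem 1 of the paper.) Fix y = (y₁,y₂,y₃) ∈ ℝ³ with y₃ > 0, a double force g ∈ ℝ³ and an orientation vector ν ∈ ℝ³. Define u^{T,W}ᵢ(x) = Σⱼ Σₖ Tᵢⱼₖ(x,y) νₖ gⱼ − Σⱼ Σₖ Tᵢⱼₖ(x,yᴵ) νᴵₖ gᴵⱼ − [x₃ ∂φᵀ/∂xᵢ(x) − δᵢ₃ φᵀ(x)], where φᵀ(x) = 2(νᴵ·gᴵ) Gᴰ[h](x,yᴵ) + 2 y₃ G^Q[νᴵ, gᴵ](x,yᴵ) with h = (0,0,1). Then u^{T,W} satisfies the no-slip condition: u^{T,W}ᵢ(x) = 0 for all i = 1,2,3 and every x = (x₁,x₂,0) with x ≠ yᴵ. -/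

import Mathlib

open Real Finset

noncomputable section

/-- Points in three-dimensional Euclidean space. -/
abbrev E3 := EuclideanSpace ℝ (Fin 3)

/-- Partial derivative `∂f/∂xᵢ` of a scalar field on `ℝ³`. -/
def pd (i : Fin 3) (f : E3 → ℝ) (x : E3) : ℝ :=
  fderiv ℝ f x (EuclideanSpace.single i 1)

/-- Kronecker delta. -/
def kron (i j : Fin 3) : ℝ := if i = j then 1 else 0

/-- Reflected image point `yᴵ = (y₁, y₂, -y₃)`. -/
def reflPt (y : E3) : E3 := (EuclideanSpace.equiv (Fin 3) ℝ).symm ![y 0, y 1, -y 2]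

/-- Reflected vector `fᴵ = (f₁, f₂, -f₃)`. -/
def reflVec (f : Fin 3 → ℝ) : Fin 3 → ℝ := ![f 0, f 1, -f 2]

/-- Harmonic potential of a unit charge, `Gˢ(x,y) = 1/(4π|x-y|)`. -/
def GS (x y : E3) : ℝ := 1 / (4 * π * ‖x - y‖)

/-- Harmonic potential of a unit dipole with orientation `ν`:
`Gᴰ[ν](x,y) = Σᵢ νᵢ ∂/∂yᵢ Gˢ(x,y)`. -/
def GD (ν : Fin 3 → ℝ) (x y : E3) : ℝ := ∑ i, ν i * pd i (fun z => GS x z) y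

/-- Harmonic potential of a unit quadrupole with orientations `ν, κ`:
`G^Q[ν,κ](x,y) = Σᵢ Σⱼ νᵢ κⱼ ∂²/∂yᵢ∂yⱼ Gˢ(x,y)`. -/
def GQ (ν κ : Fin 3 → ℝ) (x y : E3) : ℝ :=
  ∑ i, ∑ j, ν i * κ j * pd i (fun z => pd j (fun w => GS x w) z) y

/-- The stresslet (double layer kernel)
`Tᵢⱼₖ(x,y) = (3/4π)(xᵢ-yᵢ)(xⱼ-yⱼ)(xₖ-yₖ)/|x-y|⁵`. -/
def stresslet (x y : E3) (i j k : Fin 3) : ℝ :=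
  (3 / (4 * π)) * (x i - y i) * (x j - y j) * (x k - y k) / ‖x - y‖ ^ 5

/-- The Papkovich–Neuber potential for the stresslet image system:
`φᵀ(x) = 2(νᴵ·gᴵ) Gᴰ[h](x,yᴵ) + 2 y₃ G^Q[νᴵ,gᴵ](x,yᴵ)` with `h = (0,0,1)`. -/
def phiT (y : E3) (g ν : Fin 3 → ℝ) (x : E3) : ℝ :=
  2 * (∑ i, reflVec ν i * reflVec g i) * GD ![(0 : ℝ), 0, 1] x (reflPt y)
    + 2 * y 2 * GQ (reflVec ν) (reflVec g) x (reflPt y)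

/-- The half-space stresslet velocity `u^{T,W}`. -/
def uTW (y : E3) (g ν : Fin 3 → ℝ) (i : Fin 3) (x : E3) : ℝ :=
  (∑ j, ∑ k, stresslet x y i j k * ν k * g j)
    - (∑ j, ∑ k, stresslet x (reflPt y) i j k * reflVec ν k * reflVec g j)
    - (x 2 * pd i (phiT y g ν) x - if i = 2 then phiT y g ν x else 0)

/-- A directional derivative along a coordinate line computes the partial derivative. -/
lemma pd_eq_of_hasDerivAt {f : E3 → ℝ} {z : E3} {i : Fin 3} {d : ℝ}
    (hf : DifferentiableAt ℝ f z)
    (hd : HasDerivAt (fun t : ℝ => f (z + t • EuclideanSpace.single i 1)) d 0) :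
    pd i f z = d :=
  hf.lineDeriv_eq_fderiv.symm.trans hd.deriv

lemma hasDerivAt_norm_sub_line {x z : E3} (h : x ≠ z) (i : Fin 3) :
    HasDerivAt (fun t : ℝ => ‖x - (z + t • EuclideanSpace.single i (1 : ℝ))‖)
      (-(x i - z i) / ‖x - z‖) 0 := by
  have hn : ‖x - z‖ ≠ 0 := norm_ne_zero_iff.2 (sub_ne_zero.2 h)
  have h1 : HasDerivAt (fun t : ℝ => x - (z + t • EuclideanSpace.single i (1 : ℝ)))
      (-EuclideanSpace.single i (1 : ℝ)) 0 := by
    simpa using (((hasDerivAt_id (0 : ℝ)).smul_const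
      (EuclideanSpace.single i (1 : ℝ))).const_add z).const_sub x
  have h2 := h1.norm_sq.sqrt (by simpa using hn)
  simp only [Real.sqrt_sq (norm_nonneg _), zero_smul, add_zero, inner_neg_right,
    EuclideanSpace.inner_single_right] at h2
  convert h2 using 1
  simp
  field_simp

lemma differentiableAt_norm_sub {x z : E3} (h : x ≠ z) :
    DifferentiableAt ℝ (fun w : E3 => ‖x - w‖) z :=
  ((differentiableAt_const x).sub differentiableAt_id).norm ℝ (sub_ne_zero.2 h)

lemma pd_GS {x z : E3} (h : x ≠ z) (i : Fin 3) :
    pd i (fun w => GS x w) z = (x i - z i) / (4 * π * ‖x - z‖ ^ 3) := by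
  have hn : ‖x - z‖ ≠ 0 := norm_ne_zero_iff.2 (sub_ne_zero.2 h)
  have hc : 4 * π * ‖x - z‖ ≠ 0 := by positivity
  apply pd_eq_of_hasDerivAt
  · have hden : DifferentiableAt ℝ (fun w : E3 => 4 * π * ‖x - w‖) z :=
      (differentiableAt_norm_sub h).const_mul _
    simpa only [GS, one_div] using hden.fun_inv hc
  · refine ((hasDerivAt_const (0 : ℝ) (1 : ℝ)).div
      ((hasDerivAt_norm_sub_line h i).const_mul (4 * π)) (by simpa using hc)).congr_deriv ?_
    simp only [zero_smul, add_zero]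
    field_simp
    ring

lemma pd_pd_GS {x z : E3} (h : x ≠ z) (i j : Fin 3) :
    pd i (fun w => pd j (fun v => GS x v) w) z =
      3 * (x i - z i) * (x j - z j) / (4 * π * ‖x - z‖ ^ 5)
        - kron i j / (4 * π * ‖x - z‖ ^ 3) := by
  have hn : ‖x - z‖ ≠ 0 := norm_ne_zero_iff.2 (sub_ne_zero.2 h)
  have hc : 4 * π * ‖x - z‖ ^ 3 ≠ 0 := by positivity
  have he : (fun w => pd j (fun v => GS x v) w) =ᶠ[nhds z]
      fun w => (x j - w j) / (4 * π * ‖x - w‖ ^ 3) := by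
    filter_upwards [isOpen_ne.mem_nhds h.symm] with w hw
    exact pd_GS (Ne.symm hw) j
  have hp : pd i (fun w => pd j (fun v => GS x v) w) z =
      pd i (fun w => (x j - w j) / (4 * π * ‖x - w‖ ^ 3)) z := by
    unfold pd at he ⊢
    rw [he.fderiv_eq]
  rw [hp]
  apply pd_eq_of_hasDerivAt
  · have hcoord : DifferentiableAt ℝ (fun w : E3 => x j - w j) z := by fun_prop
    have hden : DifferentiableAt ℝ (fun w : E3 => 4 * π * ‖x - w‖ ^ 3) z :=
      ((differentiableAt_norm_sub h).pow 3).const_mul _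
    simpa only [div_eq_mul_inv] using hcoord.fun_mul (hden.fun_inv hc)
  · have h1 : HasDerivAt
        (fun t : ℝ => x j - (z + t • EuclideanSpace.single i (1 : ℝ)) j) (-kron i j) 0 := by
      have := (((hasDerivAt_id (0 : ℝ)).mul_const (kron i j)).const_add (z j)).const_sub (x j)
      simpa [kron, eq_comm] using this
    refine (h1.div (((hasDerivAt_norm_sub_line h i).pow 3).const_mul (4 * π))
      (by simpa using hc)).congr_deriv ?_
    simp only [zero_smul, add_zero, Pi.pow_apply]
    field_simp
    push_cast
    ring

/-- Theorem 1 of the paper: the half-space stresslet `u^{T,W}`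
satisfies the no-slip condition on the plane `x₃ = 0`. -/
theorem stresslet_halfspace_no_slip (y : E3) (hy : 0 < y 2) (g ν : Fin 3 → ℝ) :
    ∀ x : E3, x 2 = 0 → x ≠ reflPt y → ∀ i, uTW y g ν i x = 0 := by
  intro x hx hne i
  have hr0 : reflPt y 0 = y 0 := rfl
  have hr1 : reflPt y 1 = y 1 := rfl
  have hr2 : reflPt y 2 = -y 2 := rfl
  have hnorm : ‖x - y‖ = ‖x - reflPt y‖ := by
    simp [EuclideanSpace.norm_eq, Fin.sum_univ_three, hr0, hr1, hr2, hx]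
  have hn : ‖x - reflPt y‖ ≠ 0 := norm_ne_zero_iff.2 (sub_ne_zero.2 hne)
  simp only [uTW, phiT, GD, GQ, stresslet, pd_pd_GS hne, pd_GS hne, hnorm, hx, zero_mul]
  generalize ‖x - reflPt y‖ = R at hn
  fin_cases i <;>
    simp [Fin.sum_univ_three, reflVec, kron, hr0, hr1, hr2, hx] <;>
    field_simp <;>
    ring
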